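/- arXiv:1902.01174 — 2 statements merged into one kernel-verified Lean document; each statement's English description precedes it below -/
import Mathlib

section
/- Let (X, μ) be a measure space, let κ > 1 and d > 0, and let v : X → ℝ be measurable with μ({x : |v(x)| > t}) ≤ d · t^{−κ} for every t > 0. Let G : [0, ∞) → [0, ∞) be a nondecreasing continuous function with ∫₁^∞ t^{−1−κ} G(t) dt < ∞. Then for every λ > 0 one has ∫_{{|v| > λ}} G(|v|) dμ ≤ d λ^{−κ} G(λ) + d κ ∫_λ^∞ t^{−1−κ} G(t) dt. -/
open MeasureTheory

/-- A nonempty open upper set of reals which is bounded below is an open half-line. -/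
theorem IsUpperSet.eq_Ioi_csInf_of_isOpen {S : Set ℝ} (hS : IsUpperSet S) (ho : IsOpen S)
    (hne : S.Nonempty) (hb : BddBelow S) : S = Set.Ioi (sInf S) := by
  ext x
  refine ⟨fun hx => ?_, fun hx => ?_⟩
  · obtain ⟨y, hyx, hy⟩ := (mem_nhdsLT_iff_exists_Ioo_subset.1
      (mem_nhdsWithin_of_mem_nhds (ho.mem_nhds hx)))
    obtain ⟨z, hz⟩ := exists_between (Set.mem_Iio.1 hyx)
    exact (csInf_le hb (hy hz)).trans_lt hz.2
  · obtain ⟨y, hy, hyx⟩ := exists_lt_of_csInf_lt hne hx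
    exact hS hyx.le hy

/-- The measure with density `d κ t ^ (-1 - κ)` on a half-line has tails `d a ^ (-κ)`. -/
theorem lintegral_Ioi_const_mul_rpow {κ d a : ℝ} (hκ : 0 < κ) (hd : 0 ≤ d) (ha : 0 < a) :
    ∫⁻ t in Set.Ioi a, ENNReal.ofReal (d * κ * t ^ (-1 - κ)) =
      ENNReal.ofReal (d * a ^ (-κ)) := by
  rw [← ofReal_integral_eq_lintegral_ofReal, integral_const_mul,
    integral_Ioi_rpow_of_lt (by linarith) ha]
  · congr 1
    rw [show -1 - κ + 1 = -κ by ring]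
    field_simp
  · exact (integrableOn_Ioi_rpow_of_lt (by linarith) ha).const_mul _
  · filter_upwards [ae_restrict_mem measurableSet_Ioi] with t ht
    have : 0 < t := ha.trans ht
    positivity

/-- If the tails of `f` under `μ` are dominated by those of `ν` beyond `a`, then integrals of
monotone continuous functions over the tail are dominated as well. -/
theorem lintegral_tail_le_of_measure_Ioi_le {X : Type*} [MeasurableSpace X] {μ : Measure X}
    {ν : Measure ℝ} {f : X → ℝ} (hf : Measurable f) {a : ℝ}
    (h : ∀ t, a ≤ t → μ {x | t < f x} ≤ ν (Set.Ioi t))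
    {H : ℝ → ℝ} (hH_nonneg : ∀ t, 0 ≤ H t) (hH_mono : Monotone H) (hH_cont : Continuous H) :
    ∫⁻ x in {x | a < f x}, ENNReal.ofReal (H (f x)) ∂μ ≤
      ∫⁻ t in Set.Ioi a, ENNReal.ofReal (H t) ∂ν := by
  rw [lintegral_eq_lintegral_meas_lt _ (Filter.Eventually.of_forall fun x => hH_nonneg (f x))
      (hH_cont.measurable.comp hf).aemeasurable,
    lintegral_eq_lintegral_meas_lt _ (Filter.Eventually.of_forall hH_nonneg)
      hH_cont.measurable.aemeasurable]
  refine lintegral_mono fun s => ?_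
  have hSo : IsOpen ({t | s < H t} ∩ Set.Ioi a) :=
    (isOpen_lt continuous_const hH_cont).inter isOpen_Ioi
  have hSu : IsUpperSet ({t | s < H t} ∩ Set.Ioi a) := fun x y hxy hx =>
    ⟨lt_of_lt_of_le hx.1 (hH_mono hxy), lt_of_lt_of_le hx.2 hxy⟩
  have hSb : a ∈ lowerBounds ({t | s < H t} ∩ Set.Ioi a) := fun x hx => le_of_lt hx.2
  rw [Measure.restrict_apply' (measurableSet_lt measurable_const hf),
    Measure.restrict_apply' measurableSet_Ioi]
  change μ (f ⁻¹' ({t | s < H t} ∩ Set.Ioi a)) ≤ _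
  rcases ({t | s < H t} ∩ Set.Ioi a).eq_empty_or_nonempty with he | hne
  · simp [he]
  · have hb := le_csInf hne hSb
    rw [hSu.eq_Ioi_csInf_of_isOpen hSo hne ⟨a, hSb⟩]
    exact h _ hb

/-- Tail estimate: if `κ > 1`, `d > 0`, `v` is measurable with
`μ {|v| > t} ≤ d t^(-κ)` for all `t > 0`, and `G : [0,∞) → [0,∞)` is nondecreasing and
continuous with `∫₁^∞ t^(-1-κ) G(t) dt < ∞`, then for every `λ > 0`,
`∫_{|v| > λ} G(|v|) dμ ≤ d λ^(-κ) G(λ) + d κ ∫_λ^∞ t^(-1-κ) G(t) dt`. -/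
theorem tail_estimate {X : Type*} [MeasurableSpace X] (μ : Measure X)
    (κ d : ℝ) (hκ : 1 < κ) (hd : 0 < d)
    (v : X → ℝ) (hv : Measurable v)
    (hw : ∀ t : ℝ, 0 < t → μ {x | t < |v x|} ≤ ENNReal.ofReal (d * t ^ (-κ)))
    (G : ℝ → ℝ)
    (hG_nonneg : ∀ t : ℝ, 0 ≤ t → 0 ≤ G t)
    (hG_mono : MonotoneOn G (Set.Ici (0 : ℝ)))
    (hG_cont : ContinuousOn G (Set.Ici (0 : ℝ)))
    (hG_int : IntegrableOn (fun t : ℝ => t ^ (-1 - κ) * G t) (Set.Ioi (1 : ℝ))) :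
    ∀ lam : ℝ, 0 < lam →
      ∫⁻ x in {x | lam < |v x|}, ENNReal.ofReal (G |v x|) ∂μ ≤
        ENNReal.ofReal
          (d * lam ^ (-κ) * G lam + d * κ * ∫ t in Set.Ioi lam, t ^ (-1 - κ) * G t) := by
  intro lam hlam
  set H : ℝ → ℝ := fun t => G (max t 0) with hH
  have hH_eq : ∀ t, 0 ≤ t → H t = G t := fun t ht => by simp [hH, ht]
  have hH_mono : Monotone H := fun x y hxy =>
    hG_mono (Set.mem_Ici.2 (le_max_right x 0)) (Set.mem_Ici.2 (le_max_right y 0))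
      (max_le_max_right _ hxy)
  have hH_cont : Continuous H :=
    hG_cont.comp_continuous (by fun_prop) fun t => Set.mem_Ici.2 (le_max_right t 0)
  have hdens : Measurable fun t : ℝ => ENNReal.ofReal (d * κ * t ^ (-1 - κ)) := by fun_prop
  have hint : IntegrableOn (fun t : ℝ => t ^ (-1 - κ) * G t) (Set.Ioi lam) := by
    refine IntegrableOn.mono_set (t := Set.Icc lam 1 ∪ Set.Ioi 1) (IntegrableOn.union ?_ hG_int)
      fun t ht => (le_or_gt t 1).imp (fun h => ⟨le_of_lt ht, h⟩) id
    refine ContinuousOn.integrableOn_Icc (ContinuousOn.mul ?_ ?_)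
    · exact fun t ht => (Real.continuousAt_rpow_const _ _
        (Or.inl (hlam.trans_le ht.1).ne')).continuousWithinAt
    · exact hG_cont.mono fun t ht => hlam.le.trans ht.1
  have htail : ∀ t, lam ≤ t → μ {x | t < |v x|} ≤
      (volume.withDensity fun t : ℝ => ENNReal.ofReal (d * κ * t ^ (-1 - κ))) (Set.Ioi t) := by
    intro t ht
    have ht0 := hlam.trans_le ht
    rw [withDensity_apply _ measurableSet_Ioi,
      lintegral_Ioi_const_mul_rpow (by linarith) hd.le ht0]
    exact hw t ht0
  calc ∫⁻ x in {x | lam < |v x|}, ENNReal.ofReal (G |v x|) ∂μ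
      = ∫⁻ x in {x | lam < |v x|}, ENNReal.ofReal (H |v x|) ∂μ := by
        simp only [hH_eq _ (abs_nonneg _)]
    _ ≤ _ := lintegral_tail_le_of_measure_Ioi_le hv.abs htail
        (fun t => hG_nonneg _ (le_max_right _ _)) hH_mono hH_cont
    _ = ∫⁻ t in Set.Ioi lam, ENNReal.ofReal (d * κ * (t ^ (-1 - κ) * G t)) := by
        rw [restrict_withDensity measurableSet_Ioi,
          lintegral_withDensity_eq_lintegral_mul _ hdens hH_cont.measurable.ennreal_ofReal]
        refine setLIntegral_congr_fun measurableSet_Ioi fun t ht => ?_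
        have ht0 : 0 < t := hlam.trans ht
        simp only [Pi.mul_apply, hH_eq t ht0.le]
        rw [← ENNReal.ofReal_mul (by positivity), mul_assoc (d * κ)]
    _ = ENNReal.ofReal (d * κ * ∫ t in Set.Ioi lam, t ^ (-1 - κ) * G t) := by
        rw [← integral_const_mul, ofReal_integral_eq_lintegral_ofReal (hint.const_mul _)]
        filter_upwards [ae_restrict_mem measurableSet_Ioi] with t ht
        have ht0 : 0 < t := hlam.trans ht
        have := hG_nonneg t ht0.le
        positivity
    _ ≤ _ := by
        refine ENNReal.ofReal_le_ofReal (le_add_of_nonneg_left ?_)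
        have := hG_nonneg lam hlam.le
        positivity
end

section
/- Let (X, μ) be a finite measure space, let κ > 1 and d > 0, and let (v_n) be a sequence of measurable functions on X with μ({x : |v_n(x)| > t}) ≤ d · t^{−κ} for every t > 0 and every n. Let g : ℝ → ℝ be a nondecreasing continuous function with r·g(r) ≥ 0 for all r ∈ ℝ and ∫₁^∞ (g(t) − g(−t)) t^{−1−κ} dt < ∞. Then the family (g ∘ v_n) is uniformly integrable: for every ε > 0 there exists δ > 0 such that for every n and every measurable set A ⊆ X with μ(A) ≤ δ one has ∫_A |g(v_n(x))| dμ(x) ≤ ε. -/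
open MeasureTheory

/-- A monotone nonnegative function is dominated by the average of `2 h(t) / t` over `(r, 2r)`. -/
lemma ofReal_le_setLIntegral_two_mul_div {h : ℝ → ℝ} (h_mono : Monotone h) {M r : ℝ}
    (hr : 0 < r) (hMr : M ≤ r) (h_nonneg : 0 ≤ h r) :
    ENNReal.ofReal (h r) ≤
      ∫⁻ t in Set.Ioi M, {t : ℝ | t / 2 < r}.indicator (fun t => ENNReal.ofReal (2 * h t / t)) t := by
  have hsub : Set.Ioo r (2 * r) ⊆ Set.Ioi M := fun t ht => lt_of_le_of_lt hMr ht.1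
  refine le_trans ?_ (lintegral_mono_set hsub)
  have hconst : ENNReal.ofReal (h r) = ∫⁻ _ in Set.Ioo r (2 * r), ENNReal.ofReal (h r / r) := by
    rw [setLIntegral_const, Real.volume_Ioo, ← ENNReal.ofReal_mul (by positivity)]
    congr 1
    field_simp
    ring
  rw [hconst]
  refine setLIntegral_mono' measurableSet_Ioo fun t ht => ?_
  have ht0 : 0 < t := hr.trans ht.1
  have hmem : t ∈ {t : ℝ | t / 2 < r} := by
    simp only [Set.mem_ofPred_eq]
    linarith [ht.2]
  rw [Set.indicator_of_mem hmem]
  apply ENNReal.ofReal_le_ofReal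
  rw [div_le_div_iff₀ hr ht0]
  have h1 : h r ≤ h t := h_mono ht.1.le
  nlinarith [mul_le_mul_of_nonneg_left ht.2.le h_nonneg, mul_le_mul_of_nonneg_right h1 hr.le]

/-- Tail estimate for a monotone function of a function satisfying a weak-type bound. -/
lemma setLIntegral_comp_abs_le_of_weak_type {X : Type*} [MeasurableSpace X]
    (μ : Measure X) [SFinite μ] {κ d : ℝ} (hd : 0 ≤ d) {w : X → ℝ} (hw_meas : Measurable w)
    (hw : ∀ t : ℝ, 0 < t → μ {x | t < |w x|} ≤ ENNReal.ofReal (d * t ^ (-κ)))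
    {h : ℝ → ℝ} (h_mono : Monotone h) (h_nonneg : ∀ t, 0 ≤ t → 0 ≤ h t) {M : ℝ} (hM : 0 < M) :
    ∫⁻ x in {x | M < |w x|}, ENNReal.ofReal (h |w x|) ∂μ ≤
      ENNReal.ofReal (2 * d * 2 ^ κ) *
        ∫⁻ t in Set.Ioi M, ENNReal.ofReal (h t * t ^ (-1 - κ)) := by
  have hS : MeasurableSet {p : X × ℝ | p.2 / 2 < |w p.1|} :=
    measurableSet_lt (by fun_prop) (by fun_prop)
  have hK : Measurable fun t => ENNReal.ofReal (2 * h t / t) :=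
    ((h_mono.measurable.const_mul 2).div measurable_id).ennreal_ofReal
  calc ∫⁻ x in {x | M < |w x|}, ENNReal.ofReal (h |w x|) ∂μ
      ≤ ∫⁻ x in {x | M < |w x|}, (∫⁻ t in Set.Ioi M,
          {p : X × ℝ | p.2 / 2 < |w p.1|}.indicator
            (fun p => ENNReal.ofReal (2 * h p.2 / p.2)) (x, t)) ∂μ := by
        refine setLIntegral_mono' (measurableSet_lt measurable_const (by fun_prop)) fun x hx => ?_
        exact ofReal_le_setLIntegral_two_mul_div h_mono (hM.trans hx) (le_of_lt hx)
          (h_nonneg _ (abs_nonneg _))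
    _ ≤ ∫⁻ x, (∫⁻ t in Set.Ioi M,
          {p : X × ℝ | p.2 / 2 < |w p.1|}.indicator
            (fun p => ENNReal.ofReal (2 * h p.2 / p.2)) (x, t)) ∂μ := setLIntegral_le_lintegral _ _
    _ = ∫⁻ t in Set.Ioi M, (∫⁻ x,
          {p : X × ℝ | p.2 / 2 < |w p.1|}.indicator
            (fun p => ENNReal.ofReal (2 * h p.2 / p.2)) (x, t) ∂μ) :=
        lintegral_lintegral_swap ((hK.comp measurable_snd).indicator hS).aemeasurable
    _ ≤ ∫⁻ t in Set.Ioi M,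
          ENNReal.ofReal (2 * d * 2 ^ κ) * ENNReal.ofReal (h t * t ^ (-1 - κ)) := by
        refine setLIntegral_mono' measurableSet_Ioi fun t ht => ?_
        have ht0 : 0 < t := hM.trans ht
        have hslice : ∫⁻ x, {p : X × ℝ | p.2 / 2 < |w p.1|}.indicator
            (fun p => ENNReal.ofReal (2 * h p.2 / p.2)) (x, t) ∂μ =
            ENNReal.ofReal (2 * h t / t) * μ {x | t / 2 < |w x|} := by
          rw [← lintegral_indicator_const (measurableSet_lt measurable_const (by fun_prop))]
          simp [Set.indicator]
        have hht := h_nonneg t ht0.le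
        rw [hslice, ← ENNReal.ofReal_mul (by positivity)]
        refine (mul_le_mul_right (hw _ (half_pos ht0)) _).trans_eq ?_
        rw [← ENNReal.ofReal_mul (by positivity)]
        congr 1
        rw [Real.div_rpow ht0.le (by norm_num), Real.rpow_neg zero_le_two, sub_eq_add_neg,
          Real.rpow_add ht0, Real.rpow_neg_one]
        field_simp
    _ = _ := lintegral_const_mul' _ _ ENNReal.ofReal_ne_top

/-- The tails at infinity of a nonnegative integrable function tend to zero. -/
lemma exists_setLIntegral_Ioi_le {f : ℝ → ℝ} {a : ℝ} (hf : IntegrableOn f (Set.Ioi a))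
    {η : ℝ} (hη : 0 < η) :
    ∃ M, a ≤ M ∧ ∫⁻ t in Set.Ioi M, ENNReal.ofReal (f t) ≤ ENNReal.ofReal η := by
  have hanti : Antitone fun n : ℕ => Set.Ioi (a + n) := fun m n hmn =>
    Set.Ioi_subset_Ioi (by gcongr)
  have hlim := tendsto_setIntegral_of_antitone (μ := volume) (f := fun t => |f t|)
    (fun n : ℕ => measurableSet_Ioi) hanti ⟨0, by simpa [IntegrableOn] using hf.abs⟩
  have hempty : ⋂ n : ℕ, Set.Ioi (a + n) = ∅ := by
    refine Set.eq_empty_of_forall_notMem fun t ht => ?_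
    obtain ⟨n, hn⟩ := exists_nat_gt (t - a)
    have := Set.mem_iInter.1 ht n
    simp only [Set.mem_Ioi] at this
    linarith
  rw [hempty, setIntegral_empty] at hlim
  obtain ⟨n, hn⟩ := (hlim.eventually (gt_mem_nhds hη)).exists
  have hle : a ≤ a + n := by simp
  refine ⟨a + n, hle, ?_⟩
  calc ∫⁻ t in Set.Ioi (a + n), ENNReal.ofReal (f t)
      ≤ ∫⁻ t in Set.Ioi (a + n), ENNReal.ofReal |f t| :=
        lintegral_mono fun t => ENNReal.ofReal_le_ofReal (le_abs_self _)
    _ = ENNReal.ofReal (∫ t in Set.Ioi (a + n), |f t|) :=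
        (ofReal_integral_eq_lintegral_ofReal (hf.mono_set (Set.Ioi_subset_Ioi hle)).abs
          (Filter.Eventually.of_forall fun t => abs_nonneg _)).symm
    _ ≤ ENNReal.ofReal η := ENNReal.ofReal_le_ofReal hn.le

/-- A continuous function with the sign of its argument is dominated by its symmetric
increment. -/
lemma abs_le_sub_neg_abs {g : ℝ → ℝ} (hg_cont : Continuous g)
    (hg_sign : ∀ r : ℝ, 0 ≤ r * g r) (r : ℝ) : |g r| ≤ g |r| - g (-|r|) := by
  have hpos : ∀ t, 0 ≤ t → 0 ≤ g t := by
    have hcl : IsClosed {t | 0 ≤ g t} := isClosed_le continuous_const hg_cont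
    have hsub : Set.Ioi (0 : ℝ) ⊆ {t | 0 ≤ g t} := fun t ht =>
      nonneg_of_mul_nonneg_right (hg_sign t) ht
    intro t ht
    exact closure_minimal hsub hcl (by rw [closure_Ioi]; exact ht)
  have hneg : ∀ t, t ≤ 0 → g t ≤ 0 := by
    have hcl : IsClosed {t | g t ≤ 0} := isClosed_le hg_cont continuous_const
    have hsub : Set.Iio (0 : ℝ) ⊆ {t | g t ≤ 0} := fun t ht =>
      nonpos_of_mul_nonneg_right (hg_sign t) ht
    intro t ht
    exact closure_minimal hsub hcl (by rw [closure_Iio]; exact ht)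
  rcases le_total 0 r with hr | hr
  · rw [abs_of_nonneg hr, abs_of_nonneg (hpos r hr)]
    linarith [hneg (-r) (by linarith)]
  · rw [abs_of_nonpos hr, abs_of_nonpos (hneg r hr), neg_neg]
    linarith [hpos (-r) (by linarith)]

/-- Uniform integrability of `(g ∘ vₙ)`: on a finite measure space, if each `vₙ` satisfies the
uniform weak-type bound `μ {|vₙ| > t} ≤ d t^(-κ)` with `κ > 1`, and `g` is nondecreasing,
continuous, satisfies `r g(r) ≥ 0` and `∫₁^∞ (g(t) - g(-t)) t^(-1-κ) dt < ∞`, then for every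
`ε > 0` there is `δ > 0` such that `∫_A |g(vₙ)| dμ ≤ ε` for every `n` and every measurable
`A` with `μ A ≤ δ`. -/
theorem uniform_integrability {X : Type*} [MeasurableSpace X]
    (μ : Measure X) [IsFiniteMeasure μ]
    (κ d : ℝ) (hκ : 1 < κ) (hd : 0 < d)
    (v : ℕ → X → ℝ) (hv : ∀ n, Measurable (v n))
    (hw : ∀ n, ∀ t : ℝ, 0 < t → μ {x | t < |v n x|} ≤ ENNReal.ofReal (d * t ^ (-κ)))
    (g : ℝ → ℝ) (hg_cont : Continuous g) (hg_mono : Monotone g)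
    (hg_sign : ∀ r : ℝ, 0 ≤ r * g r)
    (hg_int : IntegrableOn (fun t : ℝ => (g t - g (-t)) * t ^ (-1 - κ)) (Set.Ioi (1 : ℝ))) :
    ∀ ε : ℝ, 0 < ε → ∃ δ : ℝ, 0 < δ ∧
      ∀ n : ℕ, ∀ A : Set X, MeasurableSet A → μ A ≤ ENNReal.ofReal δ →
        ∫⁻ x in A, ENNReal.ofReal |g (v n x)| ∂μ ≤ ENNReal.ofReal ε := by
  intro ε hε
  set h : ℝ → ℝ := fun t => g t - g (-t) with h_def
  have h_mono : Monotone h := fun s t hst => sub_le_sub (hg_mono hst) (hg_mono (neg_le_neg hst))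
  have h_nonneg : ∀ t, 0 ≤ t → 0 ≤ h t := fun t ht =>
    sub_nonneg.2 (hg_mono (by linarith))
  have hC : 0 < 2 * d * (2 : ℝ) ^ κ := by positivity
  obtain ⟨M, hM1, hM⟩ := exists_setLIntegral_Ioi_le hg_int
    (η := ε / 2 / (2 * d * (2 : ℝ) ^ κ)) (by positivity)
  have hM0 : 0 < M := by linarith
  have hhM : 0 ≤ h M := h_nonneg M hM0.le
  refine ⟨ε / 2 / (h M + 1), by positivity, fun n A hA hAδ => ?_⟩
  have hT : MeasurableSet {x | M < |v n x|} :=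
    measurableSet_lt measurable_const (hv n).abs
  have hpt : ∀ x, ENNReal.ofReal |g (v n x)| ≤ ENNReal.ofReal (h M) +
      {x | M < |v n x|}.indicator (fun x => ENNReal.ofReal (h |v n x|)) x := by
    intro x
    have hx : ENNReal.ofReal |g (v n x)| ≤ ENNReal.ofReal (h |v n x|) :=
      ENNReal.ofReal_le_ofReal (abs_le_sub_neg_abs hg_cont hg_sign _)
    by_cases hxM : M < |v n x|
    · rw [Set.indicator_of_mem (show x ∈ {x | M < |v n x|} from hxM)]
      exact hx.trans le_add_self
    · exact (hx.trans (ENNReal.ofReal_le_ofReal (h_mono (not_lt.1 hxM)))).trans le_self_add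
  have hlow : ENNReal.ofReal (h M) * μ A ≤ ENNReal.ofReal (ε / 2) := by
    refine (mul_le_mul_right hAδ _).trans ?_
    rw [← ENNReal.ofReal_mul hhM]
    apply ENNReal.ofReal_le_ofReal
    rw [mul_div_assoc', div_le_iff₀ (by positivity)]
    nlinarith
  have hhigh : ∫⁻ x in {x | M < |v n x|}, ENNReal.ofReal (h |v n x|) ∂μ ≤
      ENNReal.ofReal (ε / 2) := by
    refine (setLIntegral_comp_abs_le_of_weak_type μ hd.le (hv n) (hw n) h_mono h_nonneg
      hM0).trans ((mul_le_mul_right hM _).trans_eq ?_)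
    rw [← ENNReal.ofReal_mul hC.le, mul_div_cancel₀ _ hC.ne']
  calc ∫⁻ x in A, ENNReal.ofReal |g (v n x)| ∂μ
      ≤ ∫⁻ x in A, (ENNReal.ofReal (h M) +
          {x | M < |v n x|}.indicator (fun x => ENNReal.ofReal (h |v n x|)) x) ∂μ :=
        lintegral_mono hpt
    _ = ENNReal.ofReal (h M) * μ A +
          ∫⁻ x in A, {x | M < |v n x|}.indicator (fun x => ENNReal.ofReal (h |v n x|)) x ∂μ := by
        rw [lintegral_add_left measurable_const, setLIntegral_const]
    _ ≤ ENNReal.ofReal (h M) * μ A +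
          ∫⁻ x in {x | M < |v n x|}, ENNReal.ofReal (h |v n x|) ∂μ := by
        rw [← lintegral_indicator hT]
        exact add_le_add le_rfl (setLIntegral_le_lintegral _ _)
    _ ≤ ENNReal.ofReal (ε / 2) + ENNReal.ofReal (ε / 2) := add_le_add hlow hhigh
    _ = ENNReal.ofReal ε := by
        rw [← ENNReal.ofReal_add (by positivity) (by positivity), add_halves]
end
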